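/- Along the Delaunay transformation F(L,ℓ,G,g) = (q,p), the following identities hold for every (L,ℓ,G,g) ∈ D: ‖q‖ = L²·(1 − e·cos(u)) > 0; the Kepler energy satisfies ‖p‖²/2 − 1/‖q‖ = −1/(2L²); the angular momentum satisfies q₁p₂ − q₂p₁ = G; and consequently the osculating eccentricity √(1 + 2(‖p‖²/2 − 1/‖q‖)·(q₁p₂ − q₂p₁)²) equals e = √(1 − G²/L²). -/

import Mathlib

/-- The osculating eccentricity `e(L,G) = √(1 − G²/L²)`. -/
noncomputable def eLG (L G : ℝ) : ℝ := Real.sqrt (1 - G ^ 2 / L ^ 2)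

/-- The eccentric anomaly `u = u(e(L,G), ℓ)`. -/
noncomputable def uD (U : ℝ → ℝ → ℝ) (L ℓ G : ℝ) : ℝ := U (eLG L G) ℓ

/-- The radius `r = L²·(1 − e·cos u)`. -/
noncomputable def rD (U : ℝ → ℝ → ℝ) (L ℓ G : ℝ) : ℝ :=
  L ^ 2 * (1 - eLG L G * Real.cos (uD U L ℓ G))

/-- `cv = cos v = (cos u − e)/(1 − e·cos u)`. -/
noncomputable def cvD (U : ℝ → ℝ → ℝ) (L ℓ G : ℝ) : ℝ :=
  (Real.cos (uD U L ℓ G) - eLG L G) / (1 - eLG L G * Real.cos (uD U L ℓ G))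

/-- `sv = sin v = √(1−e²)·sin u/(1 − e·cos u)`. -/
noncomputable def svD (U : ℝ → ℝ → ℝ) (L ℓ G : ℝ) : ℝ :=
  Real.sqrt (1 - eLG L G ^ 2) * Real.sin (uD U L ℓ G)
    / (1 - eLG L G * Real.cos (uD U L ℓ G))

/-- First component of the unit radial vector `e_r`. -/
noncomputable def er1D (U : ℝ → ℝ → ℝ) (L ℓ G g : ℝ) : ℝ :=
  cvD U L ℓ G * Real.cos g - svD U L ℓ G * Real.sin g

/-- Second component of the unit radial vector `e_r`. -/
noncomputable def er2D (U : ℝ → ℝ → ℝ) (L ℓ G g : ℝ) : ℝ :=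
  svD U L ℓ G * Real.cos g + cvD U L ℓ G * Real.sin g

/-- `ṙ = e·sin u/(L·(1 − e·cos u))`. -/
noncomputable def rdotD (U : ℝ → ℝ → ℝ) (L ℓ G : ℝ) : ℝ :=
  eLG L G * Real.sin (uD U L ℓ G) / (L * (1 - eLG L G * Real.cos (uD U L ℓ G)))

/-- `q₁ = r·(e_r)₁`. -/
noncomputable def q1D (U : ℝ → ℝ → ℝ) (L ℓ G g : ℝ) : ℝ :=
  rD U L ℓ G * er1D U L ℓ G g

/-- `q₂ = r·(e_r)₂`. -/
noncomputable def q2D (U : ℝ → ℝ → ℝ) (L ℓ G g : ℝ) : ℝ :=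
  rD U L ℓ G * er2D U L ℓ G g

/-- `p₁ = ṙ·(e_r)₁ + (G/r)·(e_φ)₁`, with `e_φ = (−(e_r)₂, (e_r)₁)`. -/
noncomputable def p1D (U : ℝ → ℝ → ℝ) (L ℓ G g : ℝ) : ℝ :=
  rdotD U L ℓ G * er1D U L ℓ G g - (G / rD U L ℓ G) * er2D U L ℓ G g

/-- `p₂ = ṙ·(e_r)₂ + (G/r)·(e_φ)₂`. -/
noncomputable def p2D (U : ℝ → ℝ → ℝ) (L ℓ G g : ℝ) : ℝ :=
  rdotD U L ℓ G * er2D U L ℓ G g + (G / rD U L ℓ G) * er1D U L ℓ G g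

/-- Along the Delaunay transformation `F(L,ℓ,G,g) = (q,p)`:
`‖q‖ = L²(1 − e·cos u) > 0`; the Kepler energy is `‖p‖²/2 − 1/‖q‖ = −1/(2L²)`;
the angular momentum is `q₁p₂ − q₂p₁ = G`; and the osculating eccentricity
`√(1 + 2(‖p‖²/2 − 1/‖q‖)·(q₁p₂ − q₂p₁)²)` equals `e = √(1 − G²/L²)`. -/
theorem stmt_18 (U : ℝ → ℝ → ℝ)
    (hU : ∀ e ∈ Set.Ico (0:ℝ) 1, ∀ ℓ : ℝ, U e ℓ - e * Real.sin (U e ℓ) = ℓ)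
    (L ℓ G g : ℝ) (hG : 0 < G) (hGL : G < L) :
    Real.sqrt (q1D U L ℓ G g ^ 2 + q2D U L ℓ G g ^ 2) = rD U L ℓ G ∧
    0 < rD U L ℓ G ∧
    (p1D U L ℓ G g ^ 2 + p2D U L ℓ G g ^ 2) / 2
        - 1 / Real.sqrt (q1D U L ℓ G g ^ 2 + q2D U L ℓ G g ^ 2)
      = -(1 / (2 * L ^ 2)) ∧
    q1D U L ℓ G g * p2D U L ℓ G g - q2D U L ℓ G g * p1D U L ℓ G g = G ∧
    Real.sqrt (1 + 2 * ((p1D U L ℓ G g ^ 2 + p2D U L ℓ G g ^ 2) / 2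
          - 1 / Real.sqrt (q1D U L ℓ G g ^ 2 + q2D U L ℓ G g ^ 2))
        * (q1D U L ℓ G g * p2D U L ℓ G g - q2D U L ℓ G g * p1D U L ℓ G g) ^ 2)
      = eLG L G ∧
    eLG L G = Real.sqrt (1 - G ^ 2 / L ^ 2) := by
  have hL : 0 < L := hG.trans hGL
  have hq1 : G ^ 2 / L ^ 2 < 1 := by
    rw [div_lt_one (by positivity)]; nlinarith
  have hq0 : 0 < G ^ 2 / L ^ 2 := by positivity
  have he0 : 0 ≤ eLG L G := Real.sqrt_nonneg _
  have he2 : eLG L G ^ 2 = 1 - G ^ 2 / L ^ 2 := Real.sq_sqrt (by linarith)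
  have he1 : eLG L G < 1 := by nlinarith
  have hG2 : G ^ 2 = L ^ 2 * (1 - eLG L G ^ 2) := by
    rw [he2]; field_simp; ring
  have hd : 0 < 1 - eLG L G * Real.cos (uD U L ℓ G) := by
    nlinarith [Real.cos_le_one (uD U L ℓ G)]
  have hr : 0 < rD U L ℓ G := by unfold rD; positivity
  have hsc := Real.sin_sq_add_cos_sq (uD U L ℓ G)
  have hcs : cvD U L ℓ G ^ 2 + svD U L ℓ G ^ 2 = 1 := by
    unfold cvD svD
    rw [div_pow, div_pow, mul_pow, Real.sq_sqrt (by rw [he2]; linarith), ← add_div,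
      div_eq_one_iff_eq (by positivity)]
    linear_combination (1 - eLG L G ^ 2) * hsc
  have her : er1D U L ℓ G g ^ 2 + er2D U L ℓ G g ^ 2 = 1 := by
    unfold er1D er2D
    linear_combination (Real.sin g ^ 2 + Real.cos g ^ 2) * hcs + Real.sin_sq_add_cos_sq g
  have hq : Real.sqrt (q1D U L ℓ G g ^ 2 + q2D U L ℓ G g ^ 2) = rD U L ℓ G := by
    have : q1D U L ℓ G g ^ 2 + q2D U L ℓ G g ^ 2 = rD U L ℓ G ^ 2 := by
      unfold q1D q2D
      linear_combination rD U L ℓ G ^ 2 * her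
    rw [this, Real.sqrt_sq hr.le]
  have hp : p1D U L ℓ G g ^ 2 + p2D U L ℓ G g ^ 2
      = rdotD U L ℓ G ^ 2 + G ^ 2 / rD U L ℓ G ^ 2 := by
    unfold p1D p2D
    rw [← div_pow]
    linear_combination (rdotD U L ℓ G ^ 2 + (G / rD U L ℓ G) ^ 2) * her
  have hE : (p1D U L ℓ G g ^ 2 + p2D U L ℓ G g ^ 2) / 2
        - 1 / Real.sqrt (q1D U L ℓ G g ^ 2 + q2D U L ℓ G g ^ 2)
      = -(1 / (2 * L ^ 2)) := by
    rw [hq, hp, hG2]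
    unfold rdotD rD
    have hdc : Real.cos (uD U L ℓ G) * eLG L G
      = 1 - (1 - eLG L G * Real.cos (uD U L ℓ G)) := by ring
    generalize 1 - eLG L G * Real.cos (uD U L ℓ G) = d at *
    have hs : eLG L G ^ 2 * Real.sin (uD U L ℓ G) ^ 2 = eLG L G ^ 2 - (1 - d) ^ 2 := by
      rw [← hdc]; linear_combination eLG L G ^ 2 * hsc
    have hd' := hd.ne'
    rw [div_pow, mul_pow, hs]
    field_simp
    ring
  have hM : q1D U L ℓ G g * p2D U L ℓ G g - q2D U L ℓ G g * p1D U L ℓ G g = G := by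
    have h : rD U L ℓ G * (G / rD U L ℓ G) = G := by field_simp
    unfold q1D q2D p1D p2D
    linear_combination (er1D U L ℓ G g ^ 2 + er2D U L ℓ G g ^ 2) * h + G * her
  refine ⟨hq, hr, hE, hM, ?_, rfl⟩
  rw [hE, hM]
  unfold eLG
  congr 1
  field_simp
  ring
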